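/- arXiv:2604.00891 — 2 statements merged into one kernel-verified Lean document; each statement's English description precedes it below -/
import Mathlib

section
/- Let G = (V,E) be a finite undirected graph and (X,Y) a separation of G, i.e. X ∪ Y = V and G has no edge between a vertex of X \ Y and a vertex of Y \ X. Let Z = X ∩ Y, let M ⊆ Z, and let B ⊆ V be a set of vertices with B ∩ Z = M. Set B_X = B ∩ X and B_Y = B ∩ Y. Let P_X be a partition of B_X and P_Y a partition of B_Y. Let G_X = (V_X,E_X) be a subgraph of G[X] and G_Y = (V_Y,E_Y) a subgraph of G[Y] such that B_X ⊆ V_X, V_X ∩ Z = M, G_X has connected components for B_X as described by P_X, and B_Y ⊆ V_Y, V_Y ∩ Z = M, G_Y has connected components for B_Y as described by P_Y. Then the graph G' = (V_X ∪ V_Y, E_X ∪ E_Y) has connected components for B as described by the join P_X ⊔ P_Y. -/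
variable {V : Type*}

/-- `P` is a partition of the set `A`: its blocks are nonempty subsets of `A`
and every element of `A` lies in exactly one block. -/
def IsPartitionOn (P : Set (Set V)) (A : Set V) : Prop :=
  (∀ p ∈ P, p.Nonempty) ∧ (∀ p ∈ P, p ⊆ A) ∧ ∀ a ∈ A, ∃! p : Set V, p ∈ P ∧ a ∈ p

/-- Two elements lie in a common block of `P`. -/
def SameBlock (P : Set (Set V)) (a b : V) : Prop :=
  ∃ p ∈ P, a ∈ p ∧ b ∈ p

/-- The relation underlying the join (finest common coarsening, after extending both
partitions by singletons to the common ground set) of two partitions `P` and `Q`: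
the equivalence relation generated by lying in a common block of `P` or of `Q`. -/
def JoinRel (P Q : Set (Set V)) : V → V → Prop :=
  Relation.EqvGen (fun a b => SameBlock P a b ∨ SameBlock Q a b)

/-- The join `P ⊔ Q` of two partitions, as a partition of the common ground set `A`:
its blocks are the equivalence classes of `JoinRel P Q` within `A`. -/
def JoinPartition (P Q : Set (Set V)) (A : Set V) : Set (Set V) :=
  {S | ∃ a ∈ A, S = {b ∈ A | JoinRel P Q a b}}

/-- The subgraph `H` of `G` has connected components for `A` as described by `P`:
two vertices of `A` lie in the same connected component of `H` (i.e. are joined by a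
walk using edges of `H`) if and only if they lie in a common block of `P`. -/
def DescribesCC {G : SimpleGraph V} (H : G.Subgraph) (A : Set V) (P : Set (Set V)) : Prop :=
  ∀ u ∈ A, ∀ v ∈ A, (Relation.ReflTransGen H.Adj u v ↔ SameBlock P u v)

theorem sameBlock_joinPartition_iff {P Q : Set (Set V)} {A : Set V} {u v : V}
    (hu : u ∈ A) (hv : v ∈ A) : SameBlock (JoinPartition P Q A) u v ↔ JoinRel P Q u v := by
  constructor
  · rintro ⟨_, ⟨a, -, rfl⟩, ⟨-, hau⟩, ⟨-, hav⟩⟩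
    exact (hau.symm _ _).trans _ _ _ hav
  · exact fun h => ⟨_, ⟨u, hu, rfl⟩, ⟨hu, .refl u⟩, ⟨hv, h⟩⟩

theorem SimpleGraph.Subgraph.mem_verts_of_reflTransGen {G : SimpleGraph V}
    {H : G.Subgraph} {a b : V} (ha : a ∈ H.verts) (h : Relation.ReflTransGen H.Adj a b) :
    b ∈ H.verts := by
  cases h with
  | refl => exact ha
  | tail _ h => exact H.edge_vert h.symm

theorem DescribesCC.reflTransGen_of_sameBlock {G : SimpleGraph V} {H K : G.Subgraph}
    {A : Set V} {P : Set (Set V)} (h : DescribesCC H A P) (hP : IsPartitionOn P A) (hHK : H ≤ K)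
    {a b : V} (hab : SameBlock P a b) : Relation.ReflTransGen K.Adj a b := by
  obtain ⟨p, hp, ha, hb⟩ := hab
  exact Relation.ReflTransGen.mono (fun _ _ hxy => hHK.2 hxy) _ _
    ((h a (hP.2.1 p hp ha) b (hP.2.1 p hp hb)).2 ⟨p, hp, ha, hb⟩)

/-- **Joining partial solutions along a separator preserves connectivity information.**
Let `(X,Y)` be a separation of a finite graph `G`, `Z = X ∩ Y`, `M ⊆ Z`, and `B ⊆ V`
with `B ∩ Z = M`; set `B_X = B ∩ X`, `B_Y = B ∩ Y`. Let `P_X`, `P_Y` be partitions of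
`B_X`, `B_Y`, and let `H_X`, `H_Y` be subgraphs of `G[X]`, `G[Y]` with
`B_X ⊆ V(H_X)`, `V(H_X) ∩ Z = M`, `B_Y ⊆ V(H_Y)`, `V(H_Y) ∩ Z = M`, whose connected
components for `B_X`, `B_Y` are described by `P_X`, `P_Y` respectively. Then the union
graph `H_X ⊔ H_Y` has connected components for `B` as described by `P_X ⊔ P_Y`. -/
theorem connectivity_of_join {V : Type*} [Fintype V]
    {G : SimpleGraph V} (X Y : Set V)
    (hcover : X ∪ Y = Set.univ)
    (hsep : ∀ a ∈ X \ Y, ∀ b ∈ Y \ X, ¬ G.Adj a b)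
    (M B : Set V) (hM : M ⊆ X ∩ Y) (hBZ : B ∩ (X ∩ Y) = M)
    (PX PY : Set (Set V))
    (hPX : IsPartitionOn PX (B ∩ X)) (hPY : IsPartitionOn PY (B ∩ Y))
    (HX HY : G.Subgraph)
    (hHX : HX.verts ⊆ X) (hHY : HY.verts ⊆ Y)
    (hBX : B ∩ X ⊆ HX.verts) (hVXZ : HX.verts ∩ (X ∩ Y) = M)
    (hBY : B ∩ Y ⊆ HY.verts) (hVYZ : HY.verts ∩ (X ∩ Y) = M)
    (hccX : DescribesCC HX (B ∩ X) PX) (hccY : DescribesCC HY (B ∩ Y) PY) :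
    DescribesCC (HX ⊔ HY) B (JoinPartition PX PY B) := by
  intro u hu v hv
  rw [sameBlock_joinPartition_iff hu hv]
  constructor
  · intro h
    have memX : ∀ b ∈ B, b ∈ X → ∀ w, Relation.ReflTransGen HX.Adj b w → w ∈ HX.verts :=
      fun b hb hbX w => SimpleGraph.Subgraph.mem_verts_of_reflTransGen (hBX ⟨hb, hbX⟩)
    have memY : ∀ b ∈ B, b ∈ Y → ∀ w, Relation.ReflTransGen HY.Adj b w → w ∈ HY.verts :=
      fun b hb hbY w => SimpleGraph.Subgraph.mem_verts_of_reflTransGen (hBY ⟨hb, hbY⟩)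
    have memB : ∀ w ∈ HX.verts, w ∈ HY.verts → w ∈ B := fun w hwX hwY =>
      (hBZ.ge (hVXZ.le ⟨hwX, hHX hwX, hHY hwY⟩)).1
    have joinX : ∀ b ∈ B, b ∈ X → ∀ w ∈ B, Relation.ReflTransGen HX.Adj b w →
        JoinRel PX PY b w := fun b hb hbX w hw hbw =>
      .rel _ _ (.inl ((hccX b ⟨hb, hbX⟩ w ⟨hw, hHX (memX b hb hbX w hbw)⟩).1 hbw))
    have joinY : ∀ b ∈ B, b ∈ Y → ∀ w ∈ B, Relation.ReflTransGen HY.Adj b w →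
        JoinRel PX PY b w := fun b hb hbY w hw hbw =>
      .rel _ _ (.inr ((hccY b ⟨hb, hbY⟩ w ⟨hw, hHY (memY b hb hbY w hbw)⟩).1 hbw))
    -- Every vertex reachable from `u` is reachable inside one side from a vertex of `B`
    -- that is join-related to `u`.
    have reach : ∀ w, Relation.ReflTransGen (HX ⊔ HY).Adj u w → ∃ b ∈ B, JoinRel PX PY u b ∧
        (b ∈ X ∧ Relation.ReflTransGen HX.Adj b w ∨
          b ∈ Y ∧ Relation.ReflTransGen HY.Adj b w) := by
      intro w hw
      induction hw with
      | refl =>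
        exact ⟨u, hu, .refl u, (hcover.ge (Set.mem_univ u)).imp (⟨·, .refl⟩) (⟨·, .refl⟩)⟩
      | @tail w w' _ hadj ih =>
        obtain ⟨b, hb, hub, ⟨hbX, hbw⟩ | ⟨hbY, hbw⟩⟩ := ih <;>
          obtain hadj | hadj := SimpleGraph.Subgraph.sup_adj.1 hadj
        · exact ⟨b, hb, hub, .inl ⟨hbX, hbw.tail hadj⟩⟩
        · have hwY := HY.edge_vert hadj
          have hwB := memB w (memX b hb hbX w hbw) hwY
          exact ⟨w, hwB, hub.trans _ _ _ (joinX b hb hbX w hwB hbw),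
            .inr ⟨hHY hwY, .single hadj⟩⟩
        · have hwX := HX.edge_vert hadj
          have hwB := memB w hwX (memY b hb hbY w hbw)
          exact ⟨w, hwB, hub.trans _ _ _ (joinY b hb hbY w hwB hbw),
            .inl ⟨hHX hwX, .single hadj⟩⟩
        · exact ⟨b, hb, hub, .inr ⟨hbY, hbw.tail hadj⟩⟩
    obtain ⟨b, hb, hub, ⟨hbX, hbv⟩ | ⟨hbY, hbv⟩⟩ := reach v h
    · exact hub.trans _ _ _ (joinX b hb hbX v hv hbv)
    · exact hub.trans _ _ _ (joinY b hb hbY v hv hbv)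
  · intro h
    clear hu hv
    induction h with
    | rel a b hab =>
      exact hab.elim (hccX.reflTransGen_of_sameBlock hPX le_sup_left)
        (hccY.reflTransGen_of_sameBlock hPY le_sup_right)
    | refl a => exact .refl
    | symm a b _ ih =>
      exact Relation.ReflTransGen.mono (fun _ _ hxy => SimpleGraph.Subgraph.Adj.symm hxy) _ _
        (Relation.reflTransGen_swap.2 ih)
    | trans a b c _ _ hab hbc => exact hab.trans hbc
end

section
/- Let G = (V,E) be a finite undirected graph and (X,Y) a separation of G with Z = X ∩ Y, i.e. X ∪ Y = V and G has no edge between X \ Y and Y \ X. Let M ⊆ Z and B ⊆ V with B ∩ Z = M; set B_X = B ∩ X and B_Y = B ∩ Y. Let P_X be a partition of B_X and P_Y a partition of B_Y. Let E_M be the edge set of the induced subgraph G[M]. Let G_X = (V_X,E_X) and G_Y = (V_Y,E_Y) be acyclic induced subgraphs of G[X] and G[Y], respectively, such that B_X ⊆ V_X, V_X ∩ Z = M, G_X has connected components for B_X as described by P_X, and B_Y ⊆ V_Y, V_Y ∩ Z = M, G_Y has connected components for B_Y as described by P_Y. Let G'_Y = (V_Y, E_Y \ E_M) and let P'_Y be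 the partition of B_Y describing the connected components of G'_Y for B_Y. Then the induced subgraph G[V_X ∪ V_Y] is acyclic and has connected components for B as described by P_X ⊔ P_Y if and only if the pair of partitions (P_X, P'_Y) is acyclic. -/
variable {V : Type*}

/-- The bipartite graph `F_{P,Q}` associated to a pair of partitions `(P,Q)`: it has a
vertex `Sum.inl x` for every element `x`, a vertex `Sum.inr (p, false)` for every block
`p ∈ P`, a vertex `Sum.inr (q, true)` for every block `q ∈ Q`, and an edge between an
element vertex and a block vertex whenever the element lies in the block. -/
def pairGraph (P Q : Set (Set V)) : SimpleGraph (V ⊕ (Set V × Bool)) :=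
  SimpleGraph.fromRel (fun a b =>
    ∃ x p bl, a = Sum.inl x ∧ b = Sum.inr (p, bl) ∧ x ∈ p ∧
      ((bl = false ∧ p ∈ P) ∨ (bl = true ∧ p ∈ Q)))

/-- A pair `(P,Q)` of partitions is acyclic if the bipartite graph `F_{P,Q}` is acyclic. -/
def AcyclicPair (P Q : Set (Set V)) : Prop :=
  (pairGraph P Q).IsAcyclic

namespace SimpleGraph

variable {W : Type*}

/-- Inside a vertex set `S` containing all edges of `K`, reachability in `F ⊔ K` is governed
only by the reachability relation of `F` on `S` and by `K`. -/
theorem reachable_sup_of_reachable_on {F F' K : SimpleGraph W} {S : Set W}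
    (hK : ∀ u v, K.Adj u v → u ∈ S ∧ v ∈ S)
    (hF : ∀ u ∈ S, ∀ v ∈ S, F.Reachable u v → F'.Reachable u v)
    {u v : W} (hu : u ∈ S) (hv : v ∈ S) (h : (F ⊔ K).Reachable u v) :
    (F' ⊔ K).Reachable u v := by
  have key : ∀ w, Relation.ReflTransGen (F ⊔ K).Adj u w →
      ∃ s ∈ S, (F' ⊔ K).Reachable u s ∧ F.Reachable s w := by
    intro w hw
    induction hw with
    | refl => exact ⟨u, hu, .rfl, .rfl⟩
    | @tail a b _ hab ih =>
      obtain ⟨s, hs, h1, h2⟩ := ih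
      rcases hab with hab | hab
      · exact ⟨s, hs, h1, h2.trans hab.reachable⟩
      · obtain ⟨ha, hb⟩ := hK a b hab
        have hadj : (F' ⊔ K).Adj a b := Or.inr hab
        exact ⟨b, hb, (h1.trans ((hF s hs a ha h2).mono le_sup_left)).trans hadj.reachable, .rfl⟩
  obtain ⟨s, hs, h1, h2⟩ := key v ((reachable_iff_reflTransGen u v).1 h)
  exact h1.trans ((hF s hs v hv h2).mono le_sup_left)

/-- A forest may be exchanged for another forest which induces the same connectivity on `S`
without affecting acyclicity of the union with an edge-disjoint graph living on `S`. -/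
theorem isAcyclic_sup_congr [Finite W] {F F' K : SimpleGraph W} {S : Set W}
    (hFac : F.IsAcyclic) (hFac' : F'.IsAcyclic)
    (hK : ∀ u v, K.Adj u v → u ∈ S ∧ v ∈ S)
    (hF : ∀ u ∈ S, ∀ v ∈ S, F.Reachable u v ↔ F'.Reachable u v)
    (hd : ∀ u v, K.Adj u v → ¬ F.Adj u v) (hd' : ∀ u v, K.Adj u v → ¬ F'.Adj u v) :
    (F ⊔ K).IsAcyclic ↔ (F' ⊔ K).IsAcyclic := by
  have key : ∀ s : Set (Sym2 W), s.Finite → s ⊆ K.edgeSet →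
      ((F ⊔ fromEdgeSet s).IsAcyclic ↔ (F' ⊔ fromEdgeSet s).IsAcyclic) := by
    intro s hs
    induction s, hs using Set.Finite.induction_on with
    | empty => intro _; simp [hFac, hFac']
    | @insert e s _ _ ih =>
      intro hsub
      have ih := ih ((Set.subset_insert e s).trans hsub)
      have hsK : ∀ u v, (fromEdgeSet s).Adj u v → u ∈ S ∧ v ∈ S := fun u v huv =>
        hK u v (hsub (Set.mem_insert_of_mem _ ((fromEdgeSet_adj s).1 huv).1))
      induction e with
      | h u v =>
        have huv : K.Adj u v := hsub (Set.mem_insert _ _)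
        obtain ⟨hu, hv⟩ := hK u v huv
        have hr : (F ⊔ fromEdgeSet s).Reachable u v ↔ (F' ⊔ fromEdgeSet s).Reachable u v :=
          ⟨reachable_sup_of_reachable_on hsK (fun a ha b hb => (hF a ha b hb).1) hu hv,
            reachable_sup_of_reachable_on hsK (fun a ha b hb => (hF a ha b hb).2) hu hv⟩
        have hsplit : fromEdgeSet (insert s(u, v) s) =
            fromEdgeSet s ⊔ edge u v := by
          rw [edge, ← fromEdgeSet_union, Set.union_singleton]
        rw [hsplit, ← sup_assoc, ← sup_assoc, isAcyclic_sup_fromEdgeSet_iff,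
          isAcyclic_sup_fromEdgeSet_iff, ih, hr]
        simp only [sup_adj, hd u v huv, hd' u v huv]
  simpa using key K.edgeSet (Set.toFinite _) subset_rfl

theorem Reachable.exists_adj {G : SimpleGraph W} {u v : W} (h : G.Reachable u v) (hne : u ≠ v) :
    ∃ w, G.Adj u w := by
  rcases Relation.ReflTransGen.cases_head ((reachable_iff_reflTransGen u v).1 h) with h | h
  · exact absurd h hne
  · exact ⟨_, h.choose_spec.1⟩

theorem reachable_map_iff {U : Type*} (G : SimpleGraph U) (f : U ↪ W) {u v : U} :
    (G.map f).Reachable (f u) (f v) ↔ G.Reachable u v := by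
  refine ⟨fun h => ?_, fun h => h.map (Embedding.map f G).toHom⟩
  have key : ∀ w, Relation.ReflTransGen (G.map f).Adj (f u) w →
      ∃ w', f w' = w ∧ G.Reachable u w' := by
    intro w hw
    induction hw with
    | refl => exact ⟨u, rfl, .rfl⟩
    | tail _ hab ih =>
      obtain ⟨a', rfl, ha'⟩ := ih
      obtain ⟨-, c, d, hcd, hc, rfl⟩ := hab
      obtain rfl := f.injective hc
      exact ⟨d, rfl, ha'.trans hcd.reachable⟩
  obtain ⟨w', hw', hr⟩ := key _ ((reachable_iff_reflTransGen _ _).1 h)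
  exact f.injective hw' ▸ hr

theorem isAcyclic_map_iff {U : Type*} {G : SimpleGraph U} (f : U ↪ W) :
    (G.map f).IsAcyclic ↔ G.IsAcyclic := by
  refine ⟨IsAcyclic.of_map f, fun h => ?_⟩
  rw [isAcyclic_iff_forall_adj_isBridge] at h ⊢
  rintro _ _ ⟨-, u, v, huv, rfl, rfl⟩
  rw [isBridge_iff]
  intro hr
  refine isBridge_iff.1 (h huv) ((reachable_map_iff _ f).1 (hr.mono ?_))
  intro a b hab
  rw [deleteEdges_adj] at hab
  obtain ⟨⟨hne, c, d, hcd, rfl, rfl⟩, hnot⟩ := hab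
  refine ⟨hne, c, d, ?_, rfl, rfl⟩
  rw [deleteEdges_adj]
  refine ⟨hcd, fun he => hnot ?_⟩
  simpa using congrArg (Sym2.map f) (Set.mem_singleton_iff.1 he)

/-- The spanning graph of a subgraph, with extra isolated vertices of type `T` added. -/
def Subgraph.spanningSum {U : Type*} {G : SimpleGraph U} (H : G.Subgraph) (T : Type*) :
    SimpleGraph (U ⊕ T) :=
  H.spanningCoe.map (Function.Embedding.inl (β := T))

theorem Subgraph.spanningSum_adj {U T : Type*} {G : SimpleGraph U} (H : G.Subgraph)
    {x y : U ⊕ T} : (H.spanningSum T).Adj x y ↔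
      ∃ u v, H.Adj u v ∧ Sum.inl u = x ∧ Sum.inl v = y := by
  unfold Subgraph.spanningSum
  constructor
  · rintro ⟨-, u, v, huv, rfl, rfl⟩
    exact ⟨u, v, huv, rfl, rfl⟩
  · rintro ⟨u, v, huv, rfl, rfl⟩
    exact ⟨fun h => huv.ne (Sum.inl_injective h), u, v, huv, rfl, rfl⟩

theorem Subgraph.spanningSum_reachable {U T : Type*} {G : SimpleGraph U} (H : G.Subgraph)
    {u v : U} : (H.spanningSum T).Reachable (Sum.inl u) (Sum.inl v) ↔
      Relation.ReflTransGen H.Adj u v :=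
  (reachable_map_iff H.spanningCoe Function.Embedding.inl).trans (reachable_iff_reflTransGen u v)

theorem Subgraph.isAcyclic_spanningSum {U T : Type*} {G : SimpleGraph U} (H : G.Subgraph) :
    (H.spanningSum T).IsAcyclic ↔ H.coe.IsAcyclic := by
  unfold Subgraph.spanningSum
  rw [isAcyclic_map_iff, ← Subgraph.spanningCoe_coe]
  exact isAcyclic_map_iff (Function.Embedding.subtype _)

end SimpleGraph

theorem IsPartitionOn.eq_of_mem {P : Set (Set V)} {A p q : Set V} (hP : IsPartitionOn P A)
    (hp : p ∈ P) (hq : q ∈ P) {a : V} (hap : a ∈ p) (haq : a ∈ q) : p = q :=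
  (hP.2.2 a (hP.2.1 p hp hap)).unique ⟨hp, hap⟩ ⟨hq, haq⟩

theorem IsPartitionOn.mem_of_sameBlock {P : Set (Set V)} {A : Set V} (hP : IsPartitionOn P A)
    {a b : V} (h : SameBlock P a b) : a ∈ A ∧ b ∈ A := by
  obtain ⟨p, hp, ha, hb⟩ := h
  exact ⟨hP.2.1 p hp ha, hP.2.1 p hp hb⟩

/-- The element–block incidence graph of a single partition, its blocks being tagged by `c`. -/
def blockGraph (P : Set (Set V)) (c : Bool) : SimpleGraph (V ⊕ (Set V × Bool)) :=
  SimpleGraph.fromRel (fun a b => ∃ x p, a = Sum.inl x ∧ b = Sum.inr (p, c) ∧ x ∈ p ∧ p ∈ P)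

theorem blockGraph_adj {P : Set (Set V)} {c : Bool} {a b : V ⊕ (Set V × Bool)} :
    (blockGraph P c).Adj a b ↔ ∃ x p, x ∈ p ∧ p ∈ P ∧
      ((a = Sum.inl x ∧ b = Sum.inr (p, c)) ∨ (b = Sum.inl x ∧ a = Sum.inr (p, c))) := by
  unfold blockGraph
  rw [SimpleGraph.fromRel_adj]
  constructor
  · rintro ⟨-, ⟨x, p, h1, h2, h3, h4⟩ | ⟨x, p, h1, h2, h3, h4⟩⟩
    · exact ⟨x, p, h3, h4, .inl ⟨h1, h2⟩⟩
    · exact ⟨x, p, h3, h4, .inr ⟨h1, h2⟩⟩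
  · rintro ⟨x, p, h3, h4, ⟨rfl, rfl⟩ | ⟨rfl, rfl⟩⟩
    · exact ⟨by simp, .inl ⟨x, p, rfl, rfl, h3, h4⟩⟩
    · exact ⟨by simp, .inr ⟨x, p, rfl, rfl, h3, h4⟩⟩

theorem blockGraph_adj_inl {P : Set (Set V)} {c : Bool} {x : V} {b : V ⊕ (Set V × Bool)} :
    (blockGraph P c).Adj (Sum.inl x) b ↔ ∃ p ∈ P, x ∈ p ∧ b = Sum.inr (p, c) := by
  rw [blockGraph_adj]
  constructor
  · rintro ⟨y, p, hy, hp, ⟨h1, h2⟩ | ⟨h1, h2⟩⟩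
    · exact ⟨p, hp, Sum.inl_injective h1 ▸ hy, h2⟩
    · simp at h2
  · rintro ⟨p, hp, hx, rfl⟩
    exact ⟨x, p, hx, hp, .inl ⟨rfl, rfl⟩⟩

theorem blockGraph_sup (P Q : Set (Set V)) :
    blockGraph P false ⊔ blockGraph Q true = pairGraph P Q := by
  ext a b
  rw [SimpleGraph.sup_adj, blockGraph_adj, blockGraph_adj, pairGraph, SimpleGraph.fromRel_adj]
  constructor
  · rintro (⟨x, p, hx, hp, ⟨rfl, rfl⟩ | ⟨rfl, rfl⟩⟩ | ⟨x, p, hx, hp, ⟨rfl, rfl⟩ | ⟨rfl, rfl⟩⟩)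
    · exact ⟨by simp, .inl ⟨x, p, _, rfl, rfl, hx, .inl ⟨rfl, hp⟩⟩⟩
    · exact ⟨by simp, .inr ⟨x, p, _, rfl, rfl, hx, .inl ⟨rfl, hp⟩⟩⟩
    · exact ⟨by simp, .inl ⟨x, p, _, rfl, rfl, hx, .inr ⟨rfl, hp⟩⟩⟩
    · exact ⟨by simp, .inr ⟨x, p, _, rfl, rfl, hx, .inr ⟨rfl, hp⟩⟩⟩
  · rintro ⟨-, ⟨x, p, _, rfl, rfl, hx, ⟨rfl, hp⟩ | ⟨rfl, hp⟩⟩ |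
      ⟨x, p, _, rfl, rfl, hx, ⟨rfl, hp⟩ | ⟨rfl, hp⟩⟩⟩
    · exact .inl ⟨x, p, hx, hp, .inl ⟨rfl, rfl⟩⟩
    · exact .inr ⟨x, p, hx, hp, .inl ⟨rfl, rfl⟩⟩
    · exact .inl ⟨x, p, hx, hp, .inr ⟨rfl, rfl⟩⟩
    · exact .inr ⟨x, p, hx, hp, .inr ⟨rfl, rfl⟩⟩

theorem IsPartitionOn.isAcyclic_blockGraph {P : Set (Set V)} {A : Set V}
    (hP : IsPartitionOn P A) (c : Bool) : (blockGraph P c).IsAcyclic := by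
  have key : ∀ x p, x ∈ p → p ∈ P →
      (blockGraph P c).IsBridge s(Sum.inl x, Sum.inr (p, c)) := by
    intro x p hx hp
    rw [SimpleGraph.isBridge_iff]
    intro hr
    obtain ⟨w, hw⟩ := hr.exists_adj (by simp)
    rw [SimpleGraph.deleteEdges_adj, blockGraph_adj_inl] at hw
    obtain ⟨⟨q, hq, hxq, rfl⟩, hne⟩ := hw
    exact hne (by rw [hP.eq_of_mem hp hq hx hxq]; rfl)
  rw [SimpleGraph.isAcyclic_iff_forall_adj_isBridge]
  intro a b hab
  obtain ⟨x, p, hx, hp, ⟨rfl, rfl⟩ | ⟨rfl, rfl⟩⟩ := blockGraph_adj.1 hab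
  · exact key x p hx hp
  · rw [Sym2.eq_swap]
    exact key x p hx hp

theorem IsPartitionOn.blockGraph_reachable {P : Set (Set V)} {A : Set V}
    (hP : IsPartitionOn P A) (c : Bool) {u v : V} (hu : u ∈ A) :
    (blockGraph P c).Reachable (Sum.inl u) (Sum.inl v) ↔ SameBlock P u v := by
  obtain ⟨p, ⟨hp, hup⟩, -⟩ := hP.2.2 u hu
  constructor
  · intro h
    have key : ∀ w, Relation.ReflTransGen (blockGraph P c).Adj (Sum.inl u) w →
        (∃ x ∈ p, w = Sum.inl x) ∨ w = Sum.inr (p, c) := by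
      intro w hw
      induction hw with
      | refl => exact .inl ⟨u, hup, rfl⟩
      | tail _ hab ih =>
        obtain ⟨x, q, hx, hq, ⟨rfl, rfl⟩ | ⟨rfl, rfl⟩⟩ := blockGraph_adj.1 hab
        · rcases ih with ⟨y, hy, h⟩ | h
          · obtain rfl := Sum.inl_injective h
            exact .inr (by rw [hP.eq_of_mem hp hq hy hx])
          · simp at h
        · rcases ih with ⟨y, hy, h⟩ | h
          · simp at h
          · simp only [Sum.inr.injEq, Prod.mk.injEq, and_true] at h
            exact .inl ⟨x, h ▸ hx, rfl⟩
    rcases key _ ((SimpleGraph.reachable_iff_reflTransGen _ _).1 h) with ⟨x, hx, h⟩ | h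
    · obtain rfl := Sum.inl_injective h
      exact ⟨p, hp, hup, hx⟩
    · simp at h
  · rintro ⟨q, hq, hu, hv⟩
    have h1 : (blockGraph P c).Adj (Sum.inl u) (Sum.inr (q, c)) :=
      blockGraph_adj_inl.2 ⟨q, hq, hu, rfl⟩
    have h2 : (blockGraph P c).Adj (Sum.inl v) (Sum.inr (q, c)) :=
      blockGraph_adj_inl.2 ⟨q, hq, hv, rfl⟩
    exact h1.reachable.trans h2.symm.reachable

/-- If the components of `H` for `A` are described by `P`, then `H` and the incidence graph of
`P` agree on reachability between vertices that are isolated in both or belong to `A`. -/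
theorem DescribesCC.reachable_iff_blockGraph {G : SimpleGraph V} {H : G.Subgraph} {A : Set V}
    {P : Set (Set V)} (h : DescribesCC H A P) (hP : IsPartitionOn P A) (c : Bool)
    {S : Set (V ⊕ (Set V × Bool))}
    (hS : ∀ s ∈ S, ∀ t, (H.spanningSum (Set V × Bool)).Adj s t ∨ (blockGraph P c).Adj s t →
      ∃ a ∈ A, s = Sum.inl a) :
    ∀ s ∈ S, ∀ t ∈ S,
      (H.spanningSum (Set V × Bool)).Reachable s t ↔ (blockGraph P c).Reachable s t := by
  intro s hs t ht
  by_cases hst : s = t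
  · subst hst
    exact ⟨fun _ => .rfl, fun _ => .rfl⟩
  have key : (∃ a ∈ A, s = Sum.inl a) → (∃ a ∈ A, t = Sum.inl a) →
      ((H.spanningSum (Set V × Bool)).Reachable s t ↔ (blockGraph P c).Reachable s t) := by
    rintro ⟨a, ha, rfl⟩ ⟨b, hb, rfl⟩
    rw [SimpleGraph.Subgraph.spanningSum_reachable, hP.blockGraph_reachable c ha, h a ha b hb]
  constructor
  · intro hr
    obtain ⟨x, hx⟩ := hr.exists_adj hst
    obtain ⟨y, hy⟩ := hr.symm.exists_adj (Ne.symm hst)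
    exact (key (hS s hs x (.inl hx)) (hS t ht y (.inl hy))).1 hr
  · intro hr
    obtain ⟨x, hx⟩ := hr.exists_adj hst
    obtain ⟨y, hy⟩ := hr.symm.exists_adj (Ne.symm hst)
    exact (key (hS s hs x (.inr hx)) (hS t ht y (.inr hy))).2 hr

theorem reflTransGen_induce_mem {G : SimpleGraph V} {A : Set V} {u v : V}
    (h : Relation.ReflTransGen ((⊤ : G.Subgraph).induce A).Adj u v) :
    u = v ∨ (u ∈ A ∧ v ∈ A) := by
  induction h with
  | refl => exact .inl rfl
  | tail _ hab ih =>
    rcases ih with rfl | ih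
    · exact .inr ⟨hab.1, hab.2.1⟩
    · exact .inr ⟨ih.1, hab.2.1⟩

/-- If every edge of `G[A ∪ C]` lies in `G[A]` or in `G[C]` and `A ∩ C ⊆ B`, then the components
of `G[A ∪ C]` for `B` are described by the join of the partitions describing those of `G[A]`
and `G[C]`. -/
theorem describesCC_induce_union {G : SimpleGraph V} {A C B BA BC : Set V} {P Q : Set (Set V)}
    (hP : IsPartitionOn P BA) (hQ : IsPartitionOn Q BC)
    (hBA : ∀ b ∈ B, b ∈ A → b ∈ BA) (hBC : ∀ b ∈ B, b ∈ C → b ∈ BC)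
    (hAC : ∀ a ∈ A, a ∈ C → a ∈ B)
    (hedge : ∀ a b, ((⊤ : G.Subgraph).induce (A ∪ C)).Adj a b →
      ((⊤ : G.Subgraph).induce A).Adj a b ∨ ((⊤ : G.Subgraph).induce C).Adj a b)
    (hccA : DescribesCC ((⊤ : G.Subgraph).induce A) BA P)
    (hccC : DescribesCC ((⊤ : G.Subgraph).induce C) BC Q) :
    DescribesCC ((⊤ : G.Subgraph).induce (A ∪ C)) B (JoinPartition P Q B) := by
  have joinA : ∀ s ∈ B, ∀ t ∈ B, Relation.ReflTransGen ((⊤ : G.Subgraph).induce A).Adj s t →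
      JoinRel P Q s t := by
    intro s hs t ht h
    rcases reflTransGen_induce_mem h with rfl | ⟨hsA, htA⟩
    · exact .refl _
    · exact .rel _ _ (.inl ((hccA s (hBA s hs hsA) t (hBA t ht htA)).1 h))
  have joinC : ∀ s ∈ B, ∀ t ∈ B, Relation.ReflTransGen ((⊤ : G.Subgraph).induce C).Adj s t →
      JoinRel P Q s t := by
    intro s hs t ht h
    rcases reflTransGen_induce_mem h with rfl | ⟨hsC, htC⟩
    · exact .refl _
    · exact .rel _ _ (.inr ((hccC s (hBC s hs hsC) t (hBC t ht htC)).1 h))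
  intro u hu v hv
  rw [sameBlock_joinPartition_iff hu hv]
  constructor
  · intro h
    have key : ∀ w, Relation.ReflTransGen ((⊤ : G.Subgraph).induce (A ∪ C)).Adj u w →
        ∃ s ∈ B, JoinRel P Q u s ∧
          (Relation.ReflTransGen ((⊤ : G.Subgraph).induce A).Adj s w ∨
            Relation.ReflTransGen ((⊤ : G.Subgraph).induce C).Adj s w) := by
      intro w hw
      induction hw with
      | refl => exact ⟨u, hu, .refl _, .inl .refl⟩
      | @tail a b _ hab ih =>
        obtain ⟨s, hs, hus, hsa⟩ := ih
        rcases hedge a b hab with hab | hab <;> rcases hsa with hsa | hsa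
        · exact ⟨s, hs, hus, .inl (hsa.tail hab)⟩
        · have ha : a ∈ B := by
            rcases reflTransGen_induce_mem hsa with rfl | h
            · exact hs
            · exact hAC a hab.1 h.2
          exact ⟨a, ha, .trans _ _ _ hus (joinC s hs a ha hsa), .inl (.single hab)⟩
        · have ha : a ∈ B := by
            rcases reflTransGen_induce_mem hsa with rfl | h
            · exact hs
            · exact hAC a h.2 hab.1
          exact ⟨a, ha, .trans _ _ _ hus (joinA s hs a ha hsa), .inr (.single hab)⟩
        · exact ⟨s, hs, hus, .inr (hsa.tail hab)⟩
    obtain ⟨s, hs, hus, hsv | hsv⟩ := key v h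
    · exact .trans _ _ _ hus (joinA s hs v hv hsv)
    · exact .trans _ _ _ hus (joinC s hs v hv hsv)
  · intro h
    rw [show Relation.ReflTransGen ((⊤ : G.Subgraph).induce (A ∪ C)).Adj u v ↔ _ from
      (((⊤ : G.Subgraph).induce (A ∪ C)).spanningCoe.reachable_iff_reflTransGen u v).symm]
    clear hu hv
    induction h with
    | refl => exact .rfl
    | symm _ _ _ ih => exact ih.symm
    | trans _ _ _ _ _ ih1 ih2 => exact ih1.trans ih2
    | rel x y hxy =>
      rw [SimpleGraph.reachable_iff_reflTransGen]
      rcases hxy with hxy | hxy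
      · obtain ⟨hx, hy⟩ := hP.mem_of_sameBlock hxy
        exact Relation.ReflTransGen.mono (fun _ _ h => ⟨.inl h.1, .inl h.2.1, h.2.2⟩) _ _
          ((hccA x hx y hy).2 hxy)
      · obtain ⟨hx, hy⟩ := hQ.mem_of_sameBlock hxy
        exact Relation.ReflTransGen.mono (fun _ _ h => ⟨.inr h.1, .inr h.2.1, h.2.2⟩) _ _
          ((hccC x hx y hy).2 hxy)

/-- **Characterization of acyclicity of the union of two partial solutions.**
Let `(X,Y)` be a separation of a finite graph `G` with `Z = X ∩ Y`, let `M ⊆ Z` and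
`B ⊆ V` with `B ∩ Z = M`; set `B_X = B ∩ X`, `B_Y = B ∩ Y`. Let `P_X`, `P_Y` be
partitions of `B_X`, `B_Y` and let `G_X = G[V_X]`, `G_Y = G[V_Y]` be acyclic induced
subgraphs of `G[X]`, `G[Y]` with `B_X ⊆ V_X`, `V_X ∩ Z = M`, `B_Y ⊆ V_Y`, `V_Y ∩ Z = M`,
whose connected components for `B_X`, `B_Y` are described by `P_X`, `P_Y`. Let `G'_Y`
be `G_Y` with the edges of `G[M]` removed, and let `P'_Y` be the partition of `B_Y`
describing the connected components of `G'_Y` for `B_Y`. Then `G[V_X ∪ V_Y]` is acyclic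
with connected components for `B` as described by `P_X ⊔ P_Y` if and only if the pair
`(P_X, P'_Y)` is acyclic. -/
theorem acyclicity_of_join {V : Type*} [Fintype V]
    {G : SimpleGraph V} (X Y : Set V)
    (hcover : X ∪ Y = Set.univ)
    (hsep : ∀ a ∈ X \ Y, ∀ b ∈ Y \ X, ¬ G.Adj a b)
    (M B : Set V) (hM : M ⊆ X ∩ Y) (hBZ : B ∩ (X ∩ Y) = M)
    (PX PY P'Y : Set (Set V))
    (hPX : IsPartitionOn PX (B ∩ X)) (hPY : IsPartitionOn PY (B ∩ Y))
    (hP'Y : IsPartitionOn P'Y (B ∩ Y))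
    (VX VY : Set V) (hVX : VX ⊆ X) (hVY : VY ⊆ Y)
    (hacX : ((⊤ : G.Subgraph).induce VX).coe.IsAcyclic)
    (hacY : ((⊤ : G.Subgraph).induce VY).coe.IsAcyclic)
    (hBX : B ∩ X ⊆ VX) (hVXZ : VX ∩ (X ∩ Y) = M)
    (hBY : B ∩ Y ⊆ VY) (hVYZ : VY ∩ (X ∩ Y) = M)
    (hccX : DescribesCC ((⊤ : G.Subgraph).induce VX) (B ∩ X) PX)
    (hccY : DescribesCC ((⊤ : G.Subgraph).induce VY) (B ∩ Y) PY)
    (hccY' : DescribesCC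
      (((⊤ : G.Subgraph).induce VY).deleteEdges {e : Sym2 V | ∀ x ∈ e, x ∈ M})
      (B ∩ Y) P'Y) :
    (((⊤ : G.Subgraph).induce (VX ∪ VY)).coe.IsAcyclic ∧
        DescribesCC ((⊤ : G.Subgraph).induce (VX ∪ VY)) B (JoinPartition PX PY B)) ↔
      AcyclicPair PX P'Y := by
  have hmemM : ∀ a ∈ VX, a ∈ VY → a ∈ M := fun a hx hy => hVXZ ▸ ⟨hx, hVX hx, hVY hy⟩
  have hMB : M ⊆ B := fun a ha => (hBZ.symm ▸ ha : a ∈ B ∩ (X ∩ Y)).1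
  have hMX : M ⊆ VX := fun a ha => (hVXZ.symm ▸ ha : a ∈ VX ∩ (X ∩ Y)).1
  have hMY : M ⊆ VY := fun a ha => (hVYZ.symm ▸ ha : a ∈ VY ∩ (X ∩ Y)).1
  have hXY : ∀ a ∈ VX, ∀ b ∈ VY, G.Adj a b → b ∈ VX ∨ a ∈ VY := by
    intro a ha b hb hab
    by_cases haY : a ∈ Y
    · exact .inr (hMY (hVXZ ▸ ⟨ha, hVX ha, haY⟩))
    by_cases hbX : b ∈ X
    · exact .inl (hMX (hVYZ ▸ ⟨hb, hbX, hVY hb⟩))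
    · exact absurd hab (hsep a ⟨hVX ha, haY⟩ b ⟨hVY hb, hbX⟩)
  have hedge : ∀ a b, ((⊤ : G.Subgraph).induce (VX ∪ VY)).Adj a b →
      ((⊤ : G.Subgraph).induce VX).Adj a b ∨ ((⊤ : G.Subgraph).induce VY).Adj a b := by
    rintro a b ⟨ha | ha, hb | hb, hab⟩
    · exact .inl ⟨ha, hb, hab⟩
    · exact (hXY a ha b hb hab).imp (fun h => ⟨ha, h, hab⟩) (fun h => ⟨h, hb, hab⟩)
    · exact (hXY b hb a ha hab.symm).imp (fun h => ⟨h, hb, hab⟩) (fun h => ⟨ha, h, hab⟩)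
    · exact .inr ⟨ha, hb, hab⟩
  have hcc : DescribesCC ((⊤ : G.Subgraph).induce (VX ∪ VY)) B (JoinPartition PX PY B) :=
    describesCC_induce_union hPX hPY (fun b hb h => ⟨hb, hVX h⟩) (fun b hb h => ⟨hb, hVY h⟩)
      (fun a ha h => hMB (hmemM a ha h)) hedge hccX hccY
  rw [and_iff_left hcc]
  set HX := (⊤ : G.Subgraph).induce VX with hHX
  set HY := ((⊤ : G.Subgraph).induce VY).deleteEdges {e : Sym2 V | ∀ x ∈ e, x ∈ M} with hHY
  have hHXadj : ∀ a b, HX.Adj a b ↔ a ∈ VX ∧ b ∈ VX ∧ G.Adj a b := fun a b => Iff.rfl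
  have hHYadj : ∀ a b, HY.Adj a b ↔ (a ∈ VY ∧ b ∈ VY ∧ G.Adj a b) ∧ ¬ (a ∈ M ∧ b ∈ M) := by
    intro a b
    rw [hHY, SimpleGraph.Subgraph.deleteEdges_adj]
    simp
  have hdecomp : ((⊤ : G.Subgraph).induce (VX ∪ VY)).spanningSum (Set V × Bool) =
      HX.spanningSum (Set V × Bool) ⊔ HY.spanningSum (Set V × Bool) := by
    ext s t
    simp only [SimpleGraph.sup_adj, SimpleGraph.Subgraph.spanningSum_adj]
    constructor
    · rintro ⟨a, b, hab, rfl, rfl⟩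
      by_cases hM' : a ∈ M ∧ b ∈ M
      · exact .inl ⟨a, b, ⟨hMX hM'.1, hMX hM'.2, hab.2.2⟩, rfl, rfl⟩
      · rcases hedge a b hab with h | h
        · exact .inl ⟨a, b, h, rfl, rfl⟩
        · exact .inr ⟨a, b, (hHYadj a b).2 ⟨h, hM'⟩, rfl, rfl⟩
    · rintro (⟨a, b, hab, rfl, rfl⟩ | ⟨a, b, hab, rfl, rfl⟩)
      · exact ⟨a, b, ⟨.inl hab.1, .inl hab.2.1, hab.2.2⟩, rfl, rfl⟩
      · obtain ⟨h, -⟩ := (hHYadj a b).1 hab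
        exact ⟨a, b, ⟨.inr h.1, .inr h.2.1, h.2.2⟩, rfl, rfl⟩
  have hacHX : (HX.spanningSum (Set V × Bool)).IsAcyclic := HX.isAcyclic_spanningSum.2 hacX
  have hacHY : (HY.spanningSum (Set V × Bool)).IsAcyclic := by
    refine SimpleGraph.IsAcyclic.anti ?_
      (((⊤ : G.Subgraph).induce VY).isAcyclic_spanningSum (T := Set V × Bool) |>.2 hacY)
    intro s t hst
    obtain ⟨a, b, hab, rfl, rfl⟩ := (SimpleGraph.Subgraph.spanningSum_adj _).1 hst
    exact (SimpleGraph.Subgraph.spanningSum_adj _).2 ⟨a, b, ((hHYadj a b).1 hab).1, rfl, rfl⟩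
  rw [← SimpleGraph.Subgraph.isAcyclic_spanningSum (T := Set V × Bool), hdecomp, AcyclicPair,
    ← blockGraph_sup]
  have hswapX : (HX.spanningSum (Set V × Bool) ⊔ HY.spanningSum (Set V × Bool)).IsAcyclic ↔
      (blockGraph PX false ⊔ HY.spanningSum (Set V × Bool)).IsAcyclic := by
    refine SimpleGraph.isAcyclic_sup_congr (S := Sum.inl '' VY) hacHX
      (hPX.isAcyclic_blockGraph false) ?_ (hccX.reachable_iff_blockGraph hPX false ?_) ?_ ?_
    · intro s t hst
      obtain ⟨a, b, hab, rfl, rfl⟩ := (SimpleGraph.Subgraph.spanningSum_adj _).1 hst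
      obtain ⟨h, -⟩ := (hHYadj a b).1 hab
      exact ⟨⟨a, h.1, rfl⟩, ⟨b, h.2.1, rfl⟩⟩
    · rintro _ ⟨a, ha, rfl⟩ t (hst | hst)
      · obtain ⟨a', b, hab, h, rfl⟩ := (SimpleGraph.Subgraph.spanningSum_adj _).1 hst
        obtain rfl := Sum.inl_injective h
        exact ⟨a', ⟨hMB (hmemM a' hab.1 ha), hVX hab.1⟩, rfl⟩
      · obtain ⟨p, hp, hap, -⟩ := blockGraph_adj_inl.1 hst
        exact ⟨a, hPX.2.1 p hp hap, rfl⟩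
    · intro s t hst hst'
      obtain ⟨a, b, hab, rfl, rfl⟩ := (SimpleGraph.Subgraph.spanningSum_adj _).1 hst
      obtain ⟨a', b', hab', h1, h2⟩ := (SimpleGraph.Subgraph.spanningSum_adj _).1 hst'
      obtain rfl := Sum.inl_injective h1
      obtain rfl := Sum.inl_injective h2
      obtain ⟨h, hM'⟩ := (hHYadj _ _).1 hab
      exact hM' ⟨hmemM _ hab'.1 h.1, hmemM _ hab'.2.1 h.2.1⟩
    · intro s t hst hst'
      obtain ⟨a, b, hab, rfl, rfl⟩ := (SimpleGraph.Subgraph.spanningSum_adj _).1 hst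
      obtain ⟨p, -, -, h⟩ := blockGraph_adj_inl.1 hst'
      simp at h
  have hswapY : (HY.spanningSum (Set V × Bool) ⊔ blockGraph PX false).IsAcyclic ↔
      (blockGraph P'Y true ⊔ blockGraph PX false).IsAcyclic := by
    refine SimpleGraph.isAcyclic_sup_congr
      (S := Sum.inl '' (B ∩ X) ∪ Set.range fun p => Sum.inr (p, false)) hacHY
      (hP'Y.isAcyclic_blockGraph true) ?_ (hccY'.reachable_iff_blockGraph hP'Y true ?_) ?_ ?_
    · intro s t hst
      obtain ⟨x, p, hx, hp, ⟨rfl, rfl⟩ | ⟨rfl, rfl⟩⟩ := blockGraph_adj.1 hst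
      · exact ⟨.inl ⟨x, hPX.2.1 p hp hx, rfl⟩, .inr ⟨p, rfl⟩⟩
      · exact ⟨.inr ⟨p, rfl⟩, .inl ⟨x, hPX.2.1 p hp hx, rfl⟩⟩
    · rintro _ (⟨a, ha, rfl⟩ | ⟨p, rfl⟩) t (hst | hst)
      · obtain ⟨a', b, hab, h, rfl⟩ := (SimpleGraph.Subgraph.spanningSum_adj _).1 hst
        obtain rfl := Sum.inl_injective h
        exact ⟨a', ⟨ha.1, hVY ((hHYadj _ _).1 hab).1.1⟩, rfl⟩
      · obtain ⟨p, hp, hap, -⟩ := blockGraph_adj_inl.1 hst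
        exact ⟨a, hP'Y.2.1 p hp hap, rfl⟩
      · obtain ⟨a', b, hab, h, rfl⟩ := (SimpleGraph.Subgraph.spanningSum_adj _).1 hst
        simp at h
      · obtain ⟨x, q, -, -, ⟨h, -⟩ | ⟨-, h⟩⟩ := blockGraph_adj.1 hst
        · simp at h
        · simp at h
    · intro s t hst hst'
      obtain ⟨a, b, hab, rfl, rfl⟩ := (SimpleGraph.Subgraph.spanningSum_adj _).1 hst'
      obtain ⟨p, -, -, h⟩ := blockGraph_adj_inl.1 hst
      simp at h
    · intro s t hst hst'
      obtain ⟨x, p, -, -, ⟨rfl, rfl⟩ | ⟨rfl, rfl⟩⟩ := blockGraph_adj.1 hst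
      · obtain ⟨q, -, -, h⟩ := blockGraph_adj_inl.1 hst'
        simp at h
      · obtain ⟨q, -, -, h⟩ := blockGraph_adj_inl.1 hst'.symm
        simp at h
  rw [hswapX, sup_comm, hswapY, sup_comm]
end
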